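/- For X ∈ H₃(𝕆), the adjoint identity (X^#)^# = N(X)·X holds, where X^# is the sharp map and N the cubic norm. -/

import Mathlib

/- Octonions via the Cayley–Dickson construction over the quaternions. -/

noncomputable section

open Quaternion

/-- The octonions, as pairs of quaternions. -/
abbrev Oct : Type := ℍ[ℝ] × ℍ[ℝ]

/-- Cayley–Dickson multiplication: (a,b)·(c,d) = (a·c − conj(d)·b, d·a + b·conj(c)). -/
def omul (x y : Oct) : Oct :=
  ⟨x.1 * y.1 - star y.2 * x.2, y.2 * x.1 + x.2 * star y.1⟩

/-- Octonionic conjugation: conj(a,b) = (conj a, −b). -/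
def oconj (x : Oct) : Oct := ⟨star x.1, -x.2⟩

/-- The octonionic unit. -/
def oone : Oct := ⟨1, 0⟩

/-- The octonionic norm: the sum of the squares of the eight real coordinates. -/
def onorm (x : Oct) : ℝ := Quaternion.normSq x.1 + Quaternion.normSq x.2

lemma omul_add_left (x x' y : Oct) : omul (x + x') y = omul x y + omul x' y := by
  simp only [omul, Prod.fst_add, Prod.snd_add, Prod.mk_add_mk, Prod.mk.injEq, add_mul, mul_add]
  constructor <;> abel

lemma omul_add_right (x y y' : Oct) : omul x (y + y') = omul x y + omul x y' := by
  simp only [omul, Prod.fst_add, Prod.snd_add, Prod.mk_add_mk, Prod.mk.injEq, add_mul, mul_add,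
    star_add]
  constructor <;> abel

lemma omul_smul_left (r : ℝ) (x y : Oct) : omul (r • x) y = r • omul x y := by
  simp [omul, Prod.ext_iff, smul_mul_assoc, mul_smul_comm, smul_sub, smul_add]

lemma omul_smul_right (r : ℝ) (x y : Oct) : omul x (r • y) = r • omul x y := by
  simp [omul, Prod.ext_iff, smul_mul_assoc, mul_smul_comm, smul_sub, smul_add, Quaternion.star_smul]

lemma omul_zero_left (y : Oct) : omul 0 y = 0 := by
  simp [omul, Prod.ext_iff]

lemma omul_zero_right (x : Oct) : omul x 0 = 0 := by
  simp [omul, Prod.ext_iff]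


lemma oconj_add (x y : Oct) : oconj (x + y) = oconj x + oconj y := by
  simp only [oconj, Prod.fst_add, Prod.snd_add, Prod.mk_add_mk, Prod.mk.injEq]
  exact ⟨star_add _ _, by abel⟩

lemma oconj_smul (r : ℝ) (x : Oct) : oconj (r • x) = r • oconj x := by
  simp [oconj, Prod.ext_iff, Quaternion.star_smul]

lemma oconj_sum {ι : Type*} (s : Finset ι) (f : ι → Oct) :
    oconj (∑ i ∈ s, f i) = ∑ i ∈ s, oconj (f i) :=
  map_sum (AddMonoidHom.mk' oconj oconj_add) f s

lemma oconj_omul (x y : Oct) : oconj (omul x y) = omul (oconj y) (oconj x) := by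
  simp only [oconj, omul, Prod.mk.injEq]
  constructor
  · simp [star_sub, star_mul, star_star, neg_mul_neg, star_neg]
  · simp only [star_star, neg_mul, mul_neg, neg_add, neg_neg]
    abel

/-- Octonionic conjugate-transpose of a 3×3 matrix. -/
def octConjT (A : Matrix (Fin 3) (Fin 3) Oct) : Matrix (Fin 3) (Fin 3) Oct :=
  Matrix.of fun i j => oconj (A j i)

/-- Multiplication of 3×3 octonionic matrices. -/
def mmul (A B : Matrix (Fin 3) (Fin 3) Oct) : Matrix (Fin 3) (Fin 3) Oct :=
  Matrix.of fun i j => ∑ k : Fin 3, omul (A i k) (B k j)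

lemma octConjT_add (A B : Matrix (Fin 3) (Fin 3) Oct) :
    octConjT (A + B) = octConjT A + octConjT B := by
  refine Matrix.ext fun i j => ?_
  simp [octConjT, oconj_add]

lemma octConjT_smul (r : ℝ) (A : Matrix (Fin 3) (Fin 3) Oct) :
    octConjT (r • A) = r • octConjT A := by
  refine Matrix.ext fun i j => ?_
  simp [octConjT, oconj_smul]

lemma octConjT_mmul (A B : Matrix (Fin 3) (Fin 3) Oct) :
    octConjT (mmul A B) = mmul (octConjT B) (octConjT A) := by
  refine Matrix.ext fun i j => ?_
  simp [octConjT, mmul, oconj_sum, oconj_omul]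

lemma mmul_add_left (A B C : Matrix (Fin 3) (Fin 3) Oct) :
    mmul (A + B) C = mmul A C + mmul B C := by
  refine Matrix.ext fun i j => ?_
  simp [mmul, omul_add_left, Finset.sum_add_distrib]

lemma mmul_add_right (A B C : Matrix (Fin 3) (Fin 3) Oct) :
    mmul A (B + C) = mmul A B + mmul A C := by
  refine Matrix.ext fun i j => ?_
  simp [mmul, omul_add_right, Finset.sum_add_distrib]

lemma mmul_smul_left (r : ℝ) (A B : Matrix (Fin 3) (Fin 3) Oct) :
    mmul (r • A) B = r • mmul A B := by
  refine Matrix.ext fun i j => ?_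
  simp [mmul, omul_smul_left, Finset.smul_sum]

lemma mmul_smul_right (r : ℝ) (A B : Matrix (Fin 3) (Fin 3) Oct) :
    mmul A (r • B) = r • mmul A B := by
  refine Matrix.ext fun i j => ?_
  simp [mmul, omul_smul_right, Finset.smul_sum]

lemma mmul_zero_left (B : Matrix (Fin 3) (Fin 3) Oct) : mmul 0 B = 0 := by
  refine Matrix.ext fun i j => ?_
  simp [mmul, omul_zero_left]

lemma mmul_zero_right (A : Matrix (Fin 3) (Fin 3) Oct) : mmul A 0 = 0 := by
  refine Matrix.ext fun i j => ?_
  simp [mmul, omul_zero_right]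

/-- The 27-dimensional real vector space of 3×3 octonionic Hermitian matrices. -/
def hermSubmodule : Submodule ℝ (Matrix (Fin 3) (Fin 3) Oct) where
  carrier := {A | octConjT A = A}
  zero_mem' := by
    show octConjT 0 = 0
    refine Matrix.ext fun i j => ?_
    simp [octConjT, oconj, Prod.ext_iff]
  add_mem' := by
    intro A B hA hB
    show octConjT (A + B) = A + B
    rw [octConjT_add]
    rw [Set.mem_setOf_eq] at hA hB
    rw [hA, hB]
  smul_mem' := by
    intro r A hA
    show octConjT (r • A) = r • A
    rw [octConjT_smul]
    rw [Set.mem_setOf_eq] at hA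
    rw [hA]

lemma mem_hermSubmodule {A : Matrix (Fin 3) (Fin 3) Oct} :
    A ∈ hermSubmodule ↔ octConjT A = A := Iff.rfl

/-- The Albert algebra `H₃(𝕆)` as a type: 3×3 octonionic Hermitian matrices. -/
def H3 : Type := ↥hermSubmodule

instance : AddCommGroup H3 := Submodule.addCommGroup hermSubmodule
instance : Module ℝ H3 := Submodule.module hermSubmodule

/-- The underlying octonionic matrix of an element of `H₃(𝕆)`. -/
def H3.mat (X : H3) : Matrix (Fin 3) (Fin 3) Oct := Subtype.val X

lemma H3.isHerm (X : H3) : octConjT X.mat = X.mat := X.2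

/-- The Jordan product X∘Y = (1/2)(XY + YX) on `H₃(𝕆)`. -/
def jmul (X Y : H3) : H3 :=
  ⟨(1/2 : ℝ) • (mmul X.mat Y.mat + mmul Y.mat X.mat), by
    have hX : octConjT X.mat = X.mat := X.isHerm
    have hY : octConjT Y.mat = Y.mat := Y.isHerm
    rw [mem_hermSubmodule, octConjT_smul, octConjT_add, octConjT_mmul, octConjT_mmul,
      hX, hY, add_comm]⟩

/-- The trace of an element of `H₃(𝕆)` (the sum of its real diagonal entries). -/
def htrace (X : H3) : ℝ := (X.mat 0 0).1.re + (X.mat 1 1).1.re + (X.mat 2 2).1.re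

/-- The real part of an octonion. -/
def oRe (x : Oct) : ℝ := x.1.re

/-- The polar form ⟨u,v⟩ = n(u+v) − n(u) − n(v) of the octonionic norm. -/
def polar (u v : Oct) : ℝ := onorm (u + v) - onorm u - onorm v

/-- The cubic norm N(X) = λ₁λ₂λ₃ − λ₁ n(x₁) − λ₂ n(x₂) − λ₃ n(x₃) + ⟨x₁·x₂, conj(x₃)⟩
of a 3×3 octonionic Hermitian matrix, where x₁ = X₂₃, x₂ = X₃₁, x₃ = X₁₂. -/
def cubicN (A : Matrix (Fin 3) (Fin 3) Oct) : ℝ :=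
  oRe (A 0 0) * oRe (A 1 1) * oRe (A 2 2)
    - oRe (A 0 0) * onorm (A 1 2) - oRe (A 1 1) * onorm (A 2 0) - oRe (A 2 2) * onorm (A 0 1)
    + polar (omul (A 1 2) (A 2 0)) (oconj (A 0 1))

/-- The sharp (adjoint) map on 3×3 octonionic Hermitian matrices, with
x₁ = X₂₃, x₂ = X₃₁, x₃ = X₁₂ and λᵢ the diagonal entries. -/
def sharp (A : Matrix (Fin 3) (Fin 3) Oct) : Matrix (Fin 3) (Fin 3) Oct :=
  !![(oRe (A 1 1) * oRe (A 2 2) - onorm (A 1 2)) • oone,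
      omul (oconj (A 2 0)) (oconj (A 1 2)) - oRe (A 2 2) • A 0 1,
      omul (A 0 1) (A 1 2) - oRe (A 1 1) • oconj (A 2 0);
    omul (A 1 2) (A 2 0) - oRe (A 2 2) • oconj (A 0 1),
      (oRe (A 0 0) * oRe (A 2 2) - onorm (A 2 0)) • oone,
      omul (oconj (A 0 1)) (oconj (A 2 0)) - oRe (A 0 0) • A 1 2;
    omul (oconj (A 1 2)) (oconj (A 0 1)) - oRe (A 1 1) • A 2 0,
      omul (A 2 0) (A 0 1) - oRe (A 0 0) • oconj (A 1 2),
      (oRe (A 0 0) * oRe (A 1 1) - onorm (A 0 1)) • oone]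

/-- The trilinear form `⟨x·y, conj z⟩` that enters the cubic norm. -/
def otri (x y z : Oct) : ℝ := polar (omul x y) (oconj z)

lemma oconj_oconj (x : Oct) : oconj (oconj x) = x := by
  simp [oconj]

lemma oconj_sub (x y : Oct) : oconj (x - y) = oconj x - oconj y := by
  rw [sub_eq_add_neg, oconj_add, ← neg_one_smul ℝ y, oconj_smul, neg_one_smul, ← sub_eq_add_neg]

lemma oconj_oone : oconj oone = oone := by
  simp [oconj, oone]

lemma oRe_oone : oRe oone = 1 := by
  simp [oRe, oone]

lemma oRe_smul (r : ℝ) (x : Oct) : oRe (r • x) = r * oRe x := by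
  simp [oRe]

lemma omul_sub_left (x x' y : Oct) : omul (x - x') y = omul x y - omul x' y := by
  rw [eq_sub_iff_add_eq, ← omul_add_left, sub_add_cancel]

lemma omul_sub_right (x y y' : Oct) : omul x (y - y') = omul x y - omul x y' := by
  rw [eq_sub_iff_add_eq, ← omul_add_right, sub_add_cancel]

lemma onorm_oconj (x : Oct) : onorm (oconj x) = onorm x := by
  simp [onorm, oconj]

lemma onorm_omul (x y : Oct) : onorm (omul x y) = onorm x * onorm y := by
  simp [onorm, omul, Quaternion.normSq_def']
  ring

lemma onorm_sub_smul (r : ℝ) (x y : Oct) :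
    onorm (x - r • y) = onorm x - r * polar x y + r ^ 2 * onorm y := by
  simp [onorm, polar, Quaternion.normSq_def']
  ring

lemma polar_oconj (x y : Oct) : polar (oconj x) (oconj y) = polar x y := by
  simp only [polar, ← oconj_add, onorm_oconj]

lemma otri_rotate (x y z : Oct) : otri x y z = otri y z x := by
  simp [otri, polar, onorm, omul, oconj, Quaternion.normSq_def']
  ring

lemma polar_omul_oconj_oconj (x y z : Oct) :
    polar (omul (oconj z) (oconj y)) x = otri x y z := by
  rw [otri_rotate x y z, ← polar_oconj, oconj_omul, oconj_oconj, oconj_oconj, otri]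

lemma omul_oconj_mul_cancel (x y : Oct) :
    omul (oconj x) (omul x y) = onorm x • y := by
  ext <;> simp [omul, oconj, onorm, Quaternion.normSq_def'] <;> ring

lemma omul_mul_oconj_cancel (x y : Oct) :
    omul (omul y x) (oconj x) = onorm x • y := by
  ext <;> simp [omul, oconj, onorm, Quaternion.normSq_def'] <;> ring

lemma omul_omul_self (w z : Oct) :
    omul (omul z w) z = polar w (oconj z) • z - onorm z • oconj w := by
  ext <;> simp [polar, omul, oconj, onorm, Quaternion.normSq_def'] <;> ring

set_option maxHeartbeats 1000000 in
/-- The middle Moufang identity. -/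
lemma omul_moufang (x y z : Oct) :
    omul (omul z x) (omul y z) = omul (omul z (omul x y)) z := by
  ext <;>
    simp only [omul, Quaternion.re_mul, Quaternion.imI_mul, Quaternion.imJ_mul,
      Quaternion.imK_mul, Quaternion.re_sub, Quaternion.imI_sub, Quaternion.imJ_sub,
      Quaternion.imK_sub, Quaternion.re_add, Quaternion.imI_add, Quaternion.imJ_add,
      Quaternion.imK_add, Quaternion.re_star, Quaternion.imI_star, Quaternion.imJ_star,
      Quaternion.imK_star] <;>
    ring

/-- The middle Moufang identity, with `z(xy)z` expanded through the polar form. -/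
lemma omul_omul_omul_omul (x y z : Oct) :
    omul (omul z x) (omul y z) = otri x y z • z - onorm z • omul (oconj y) (oconj x) := by
  rw [omul_moufang, omul_omul_self, oconj_omul, otri]

/-- The diagonal part of the adjoint identity. -/
lemma sharp_sharp_diag (a b c : ℝ) (x y z : Oct) :
    (a * c - onorm y) * (a * b - onorm z) - onorm (omul (oconj z) (oconj y) - a • x) =
      (a * b * c - a * onorm x - b * onorm y - c * onorm z + otri x y z) * a := by
  rw [onorm_sub_smul, onorm_omul, onorm_oconj, onorm_oconj, polar_omul_oconj_oconj]
  ring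

/-- The off-diagonal part of the adjoint identity. -/
lemma sharp_sharp_offDiag (a b c : ℝ) (x y z : Oct) :
    omul (oconj (omul (oconj x) (oconj z) - b • y)) (oconj (omul (oconj z) (oconj y) - a • x)) -
        (a * b - onorm z) • (omul (oconj y) (oconj x) - c • z) =
      (a * b * c - a * onorm x - b * onorm y - c * onorm z + otri x y z) • z := by
  have hx : omul (omul z x) (oconj x) = onorm x • z := omul_mul_oconj_cancel x z
  have hy : omul (oconj y) (omul y z) = onorm y • z := omul_oconj_mul_cancel y z
  simp only [oconj_sub, oconj_smul, oconj_omul, oconj_oconj, omul_sub_left, omul_sub_right,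
    omul_smul_left, omul_smul_right, omul_omul_omul_omul, hx, hy]
  module

lemma octConjT_sharp (A : Matrix (Fin 3) (Fin 3) Oct) : octConjT (sharp A) = sharp A := by
  ext1 i j
  fin_cases i <;> fin_cases j <;>
    simp [octConjT, sharp, oconj_sub, oconj_smul, oconj_omul, oconj_oconj, oconj_oone]

lemma eq_oRe_smul_oone {x : Oct} (hx : oconj x = x) : x = oRe x • oone := by
  have h₁ : star x.1 = x.1 := congrArg Prod.fst hx
  have h₂ : -x.2 = x.2 := congrArg Prod.snd hx
  refine Prod.ext ?_ ?_
  · simpa [oRe, oone, ← Quaternion.coe_mul_eq_smul] using Quaternion.star_eq_self.1 h₁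
  · rw [Prod.smul_snd, oone, smul_zero]
    linear_combination (norm := module) (-(1 / 2 : ℝ)) • h₂

lemma ext_of_octConjT {A B : Matrix (Fin 3) (Fin 3) Oct} (hA : octConjT A = A)
    (hB : octConjT B = B) (h₀ : oRe (A 0 0) = oRe (B 0 0)) (h₁ : oRe (A 1 1) = oRe (B 1 1))
    (h₂ : oRe (A 2 2) = oRe (B 2 2)) (h₀₁ : A 0 1 = B 0 1) (h₁₂ : A 1 2 = B 1 2)
    (h₂₀ : A 2 0 = B 2 0) : A = B := by
  have hA' (i j) : oconj (A j i) = A i j := congrFun₂ hA i j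
  have hB' (i j) : oconj (B j i) = B i j := congrFun₂ hB i j
  have hd (i) (h : oRe (A i i) = oRe (B i i)) : A i i = B i i := by
    rw [eq_oRe_smul_oone (hA' i i), eq_oRe_smul_oone (hB' i i), h]
  have hs (i j) (h : A j i = B j i) : A i j = B i j := by rw [← hA', ← hB', h]
  ext1 i j
  fin_cases i <;> fin_cases j
  exacts [hd 0 h₀, h₀₁, hs 0 2 h₂₀, hs 1 0 h₀₁, hd 1 h₁, h₁₂, h₂₀, hs 2 1 h₁₂, hd 2 h₂]

/-- STATEMENT 8: the adjoint identity (X^#)^# = N(X)·X on `H₃(𝕆)`. -/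
theorem sharp_sharp (A : Matrix (Fin 3) (Fin 3) Oct) (hA : octConjT A = A) :
    sharp (sharp A) = cubicN A • A := by
  have hN : cubicN A = oRe (A 0 0) * oRe (A 1 1) * oRe (A 2 2) - oRe (A 0 0) * onorm (A 1 2)
      - oRe (A 1 1) * onorm (A 2 0) - oRe (A 2 2) * onorm (A 0 1)
      + otri (A 1 2) (A 2 0) (A 0 1) := rfl
  have ht₁ := otri_rotate (A 1 2) (A 2 0) (A 0 1)
  have ht₂ := otri_rotate (A 0 1) (A 1 2) (A 2 0)
  refine ext_of_octConjT (octConjT_sharp _) (by rw [octConjT_smul, hA]) ?_ ?_ ?_ ?_ ?_ ?_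
  · have h := sharp_sharp_diag (oRe (A 0 0)) (oRe (A 1 1)) (oRe (A 2 2)) (A 1 2) (A 2 0) (A 0 1)
    simp [sharp, oRe_smul, oRe_oone, hN]
    linear_combination h
  · have h := sharp_sharp_diag (oRe (A 1 1)) (oRe (A 2 2)) (oRe (A 0 0)) (A 2 0) (A 0 1) (A 1 2)
    simp [sharp, oRe_smul, oRe_oone, hN]
    linear_combination h - oRe (A 1 1) * ht₁
  · have h := sharp_sharp_diag (oRe (A 2 2)) (oRe (A 0 0)) (oRe (A 1 1)) (A 0 1) (A 1 2) (A 2 0)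
    simp [sharp, oRe_smul, oRe_oone, hN]
    linear_combination h + oRe (A 2 2) * ht₂
  · have h := sharp_sharp_offDiag (oRe (A 0 0)) (oRe (A 1 1)) (oRe (A 2 2))
      (A 1 2) (A 2 0) (A 0 1)
    simp [sharp, oRe_smul, oRe_oone, hN]
    linear_combination (norm := module) h
  · have h := sharp_sharp_offDiag (oRe (A 1 1)) (oRe (A 2 2)) (oRe (A 0 0))
      (A 2 0) (A 0 1) (A 1 2)
    rw [← ht₁] at h
    simp [sharp, oRe_smul, oRe_oone, hN]
    linear_combination (norm := module) h
  · have h := sharp_sharp_offDiag (oRe (A 2 2)) (oRe (A 0 0)) (oRe (A 1 1))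
      (A 0 1) (A 1 2) (A 2 0)
    rw [ht₂] at h
    simp [sharp, oRe_smul, oRe_oone, hN]
    linear_combination (norm := module) h
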